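/- For u ∈ Ω, the entropy variable v(u) = ∇_u U(u), i.e., the gradient of U(u) = -ρ ln(det p/ρ⁴) with respect to the conservative variables u = (ρ, m^x, m^y, E^{xx}, E^{xy}, E^{yy}), is given explicitly by v = (4 - s - (ρ/det p)(p^{yy}(v^x)² - 2p^{xy}v^x v^y + p^{xx}(v^y)²), 2ρ(p^{yy}v^x - p^{xy}v^y)/det p, 2ρ(p^{xx}v^y - p^{xy}v^x)/det p, -ρ p^{yy}/det p, 2ρ p^{xy}/det p, -ρ p^{xx}/det p), where s = ln(det p/ρ⁴). -/

import Mathlib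

/-!
Ten-moment Gaussian closure equations: basic definitions.
Conservative state `u = (ρ, mˣ, mʸ, Eˣˣ, Eˣʸ, Eʸʸ) ∈ ℝ⁶`.
-/

noncomputable section

namespace TenMoment

/-- The space of conservative variables: vectors in `ℝ⁶`. -/
abbrev St : Type := Fin 6 → ℝ

/-- Density `ρ`. -/
def rho (u : St) : ℝ := u 0
/-- Velocity `vˣ = mˣ/ρ`. -/
def vx (u : St) : ℝ := u 1 / u 0
/-- Velocity `vʸ = mʸ/ρ`. -/
def vy (u : St) : ℝ := u 2 / u 0
/-- Pressure component `pˣˣ = Eˣˣ - ρ vˣ vˣ`. -/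
def pxx (u : St) : ℝ := u 3 - rho u * vx u * vx u
/-- Pressure component `pˣʸ = Eˣʸ - ρ vˣ vʸ`. -/
def pxy (u : St) : ℝ := u 4 - rho u * vx u * vy u
/-- Pressure component `pʸʸ = Eʸʸ - ρ vʸ vʸ`. -/
def pyy (u : St) : ℝ := u 5 - rho u * vy u * vy u
/-- The symmetric 2×2 pressure tensor. -/
def pmat (u : St) : Matrix (Fin 2) (Fin 2) ℝ := !![pxx u, pxy u; pxy u, pyy u]
/-- `det p`. -/
def detp (u : St) : ℝ := pxx u * pyy u - pxy u * pxy u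

/-- The admissible set `Ω`: positive density and positive definite pressure tensor. -/
def admissible (u : St) : Prop := 0 < rho u ∧ (pmat u).PosDef

/-- Entropy `U(u) = -ρ ln (det p / ρ⁴)`. -/
def entU (u : St) : ℝ := - rho u * Real.log (detp u / (rho u) ^ 4)
/-- Entropy flux (x-direction) `F(u) = -ρ vˣ ln (det p / ρ⁴)`. -/
def entF (u : St) : ℝ := - rho u * vx u * Real.log (detp u / (rho u) ^ 4)
/-- Entropy flux (y-direction) `G(u) = -ρ vʸ ln (det p / ρ⁴)`. -/
def entG (u : St) : ℝ := - rho u * vy u * Real.log (detp u / (rho u) ^ 4)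

/-- The x-direction flux of the ten-moment system. -/
def fluxF (u : St) : St :=
  ![rho u * vx u,
    rho u * vx u ^ 2 + pxx u,
    rho u * vx u * vy u + pxy u,
    rho u * vx u ^ 3 + 3 * vx u * pxx u,
    rho u * vx u ^ 2 * vy u + 2 * vx u * pxy u + vy u * pxx u,
    rho u * vx u * vy u ^ 2 + vx u * pyy u + 2 * vy u * pxy u]

/-- The y-direction flux of the ten-moment system. -/
def fluxG (u : St) : St :=
  ![rho u * vy u,
    rho u * vx u * vy u + pxy u,
    rho u * vy u ^ 2 + pyy u,
    rho u * vy u * vx u ^ 2 + vy u * pxx u + 2 * vx u * pxy u,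
    rho u * vy u ^ 2 * vx u + 2 * vy u * pxy u + vx u * pyy u,
    rho u * vy u ^ 3 + 3 * vy u * pyy u]

/-- The gradient of the entropy `U` with respect to the conservative variables
(the entropy variable `v(u) = ∇ᵤ U(u)`). -/
def gradU (u : St) : St := fun i => fderiv ℝ entU u (Pi.single i 1)

/-- Euclidean dot product on `ℝ⁶`. -/
def dot (a b : St) : ℝ := ∑ i, a i * b i

/-- The x-direction source term, for a pointwise value `Wx` of `∂ₓW`. -/
def srcX (Wx : ℝ) (u : St) : St :=
  ![0, -(1/2) * rho u * Wx, 0, -(rho u * vx u * Wx), -(1/2) * rho u * vy u * Wx, 0]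

/-- The y-direction source term, for a pointwise value `Wy` of `∂_y W`. -/
def srcY (Wy : ℝ) (u : St) : St :=
  ![0, 0, -(1/2) * rho u * Wy, 0, -(1/2) * rho u * vx u * Wy, -(rho u * vy u * Wy)]

/-- The x-direction entropy potential `ψ(u) = v(u)·f(u) - F(u)`. -/
def psiX (u : St) : ℝ := dot (gradU u) (fluxF u) - entF u

/-- The Jacobian `Df(u)` of the x-direction flux with respect to the conservative variables. -/
def jacF (u : St) : Matrix (Fin 6) (Fin 6) ℝ :=
  fun i j => fderiv ℝ (fun w => fluxF w i) u (Pi.single j 1)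

/-- The boundary coefficients `τ₀ = -1`, `τ_k = 1`, `τ_j = 0` otherwise. -/
def tau (k : ℕ) : Fin (k+1) → ℝ :=
  fun j => if (j : ℕ) = 0 then -1 else if (j : ℕ) = k then 1 else 0

/-- The logarithmic mean: `(b-a)/(ln b - ln a)` for `a ≠ b`, and `a` when `a = b`. -/
def logMean (a b : ℝ) : ℝ := if a = b then a else (b - a) / (Real.log b - Real.log a)

/-- The arithmetic mean. -/
def avg (a b : ℝ) : ℝ := (a + b) / 2

/-- Auxiliary variable `D = det p / ρ`. -/
def Dq (u : St) : ℝ := detp u / rho u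
/-- `β_{xx} = pˣˣ/D`. -/
def bxx (u : St) : ℝ := pxx u / Dq u
/-- `β_{xy} = pˣʸ/D`. -/
def bxy (u : St) : ℝ := pxy u / Dq u
/-- `β_{yy} = pʸʸ/D`. -/
def byy (u : St) : ℝ := pyy u / Dq u
/-- `D_β = β_{xx} β_{yy} - β_{xy}²`. -/
def Db (u : St) : ℝ := bxx u * byy u - bxy u ^ 2

/-- The entropy conservative two-point flux of Sen–Kumar for the x-direction. -/
def fstarEC (uL uR : St) : St :=
  let rln := logMean (rho uL) (rho uR)
  let vxb := avg (vx uL) (vx uR)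
  let vyb := avg (vy uL) (vy uR)
  let rb := avg (rho uL) (rho uR)
  let bxxb := avg (bxx uL) (bxx uR)
  let bxyb := avg (bxy uL) (bxy uR)
  let byyb := avg (byy uL) (byy uR)
  let Dbln := logMean (Db uL) (Db uR)
  let vx2b := avg (vx uL ^ 2) (vx uR ^ 2)
  let vy2b := avg (vy uL ^ 2) (vy uR ^ 2)
  let vxyb := avg (vx uL * vy uL) (vx uR * vy uR)
  let f1 := rln * vxb
  let f2 := f1 * vxb + rb * bxxb / (bxxb * byyb - bxyb ^ 2)
  let f3 := f1 * vyb + rb * bxyb / (bxxb * byyb - bxyb ^ 2)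
  ![f1, f2, f3,
    (bxxb / Dbln - vx2b) * f1 + 2 * vxb * f2,
    (bxyb / Dbln - vxyb) * f1 + vxb * f3 + vyb * f2,
    (byyb / Dbln - vy2b) * f1 + 2 * vyb * f3]

end TenMoment

namespace TenMoment

/-- The explicit formula for the entropy variable, with `s = ln(det p / ρ⁴)`. -/
def entVar (u : St) : St :=
  ![4 - Real.log (detp u / rho u ^ 4)
      - (rho u / detp u) * (pyy u * vx u ^ 2 - 2 * pxy u * vx u * vy u + pxx u * vy u ^ 2),
    2 * rho u * (pyy u * vx u - pxy u * vy u) / detp u,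
    2 * rho u * (pxx u * vy u - pxy u * vx u) / detp u,
    -(rho u * pyy u / detp u),
    2 * rho u * pxy u / detp u,
    -(rho u * pxx u / detp u)]

end TenMoment

namespace TenMoment

lemma detp_pos_of_admissible (u : St) (hu : admissible u) : 0 < detp u := by
  have h := hu.2.det_pos
  rw [pmat, Matrix.det_fin_two_of] at h
  exact h

lemma differentiableAt_entU (u : St) (hr : 0 < rho u) (hd : 0 < detp u) :
    DifferentiableAt ℝ entU u := by
  have hr0 : u 0 ≠ 0 := hr.ne'
  have h0 : DifferentiableAt ℝ rho u := by unfold rho; fun_prop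
  have h1 : DifferentiableAt ℝ vx u := by unfold vx; fun_prop (disch := assumption)
  have h2 : DifferentiableAt ℝ vy u := by unfold vy; fun_prop (disch := assumption)
  have h3 : DifferentiableAt ℝ pxx u := by unfold pxx; fun_prop
  have h4 : DifferentiableAt ℝ pxy u := by unfold pxy; fun_prop
  have h5 : DifferentiableAt ℝ pyy u := by unfold pyy; fun_prop
  have h6 : DifferentiableAt ℝ detp u := by unfold detp; fun_prop
  have h7 : rho u ^ 4 ≠ 0 := (pow_pos hr 4).ne'
  have h8 : detp u / rho u ^ 4 ≠ 0 := (div_pos hd (pow_pos hr 4)).ne'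
  unfold entU
  fun_prop (disch := assumption)

/-- Directional derivative of the entropy. -/
lemma fderiv_entU_apply (u e : St) (hr : 0 < rho u) (hd : 0 < detp u) :
    fderiv ℝ entU u e = ∑ k, e k * entVar u k := by
  have hr0 : u 0 ≠ 0 := hr.ne'
  have hline : HasDerivAt (fun t : ℝ => u + t • e) e 0 := by
    simpa using ((hasDerivAt_id (0 : ℝ)).smul_const e).const_add u
  have hu0 : u + (0 : ℝ) • e = u := by simp
  have hA : HasDerivAt (fun t : ℝ => entU (u + t • e)) (fderiv ℝ entU u e) 0 := by
    have hf : HasFDerivAt entU (fderiv ℝ entU u) (u + (0 : ℝ) • e) := by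
      rw [hu0]; exact (differentiableAt_entU u hr hd).hasFDerivAt
    exact hf.comp_hasDerivAt (0 : ℝ) hline
  have hc : ∀ k, HasDerivAt (fun t : ℝ => (u + t • e) k) (e k) 0 := hasDerivAt_pi.1 hline
  have hx0 : (u + (0 : ℝ) • e) 0 ≠ 0 := by rw [hu0]; exact hr0
  have h0 : HasDerivAt (fun t : ℝ => rho (u + t • e)) (e 0) 0 := hc 0
  have h1 : HasDerivAt (fun t : ℝ => vx (u + t • e)) ((e 1 - vx u * e 0) / rho u) 0 := by
    refine HasDerivAt.congr_deriv ((hc 1).div (hc 0) hx0) ?_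
    rw [hu0, vx, rho]; field_simp
  have h2 : HasDerivAt (fun t : ℝ => vy (u + t • e)) ((e 2 - vy u * e 0) / rho u) 0 := by
    refine HasDerivAt.congr_deriv ((hc 2).div (hc 0) hx0) ?_
    rw [hu0, vy, rho]; field_simp
  have hr1 : rho u ≠ 0 := hr.ne'
  have h3 : HasDerivAt (fun t : ℝ => pxx (u + t • e))
      (e 3 - 2 * vx u * e 1 + vx u ^ 2 * e 0) 0 := by
    refine HasDerivAt.congr_deriv ((hc 3).sub ((h0.mul h1).mul h1)) ?_
    simp only [Pi.mul_apply, hu0]; field_simp; ring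
  have h4 : HasDerivAt (fun t : ℝ => pxy (u + t • e))
      (e 4 - vx u * e 2 - vy u * e 1 + vx u * vy u * e 0) 0 := by
    refine HasDerivAt.congr_deriv ((hc 4).sub ((h0.mul h1).mul h2)) ?_
    simp only [Pi.mul_apply, hu0]; field_simp; ring
  have h5 : HasDerivAt (fun t : ℝ => pyy (u + t • e))
      (e 5 - 2 * vy u * e 2 + vy u ^ 2 * e 0) 0 := by
    refine HasDerivAt.congr_deriv ((hc 5).sub ((h0.mul h2).mul h2)) ?_
    simp only [Pi.mul_apply, hu0]; field_simp; ring
  have h6 := (h3.mul h5).sub (h4.mul h4)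
  have h7 : rho (u + (0 : ℝ) • e) ^ 4 ≠ 0 := by rw [hu0]; exact (pow_pos hr 4).ne'
  have h8 : detp (u + (0 : ℝ) • e) / rho (u + (0 : ℝ) • e) ^ 4 ≠ 0 := by
    rw [hu0]; exact (div_pos hd (pow_pos hr 4)).ne'
  have hB := h0.neg.mul ((h6.div (h0.pow 4) h7).log h8)
  refine (hA.unique hB).trans ?_
  have hd1 : detp u ≠ 0 := hd.ne'
  have hdd : pxx u * pyy u - pxy u * pxy u = detp u := rfl
  simp only [Pi.mul_apply, Pi.sub_apply, Pi.div_apply, Pi.pow_apply, Pi.neg_apply, hu0, hdd,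
    Fin.sum_univ_six, entVar]
  simp
  field_simp
  ring

end TenMoment

open TenMoment in
/-- For `u ∈ Ω`, the entropy variable `v(u) = ∇ᵤU(u)` is given by the
explicit formula `entVar`. -/
theorem tenMoment_entropy_variable_formula (u : St) (hu : admissible u) (i : Fin 6) :
    fderiv ℝ entU u (Pi.single i 1) = entVar u i := by
  rw [fderiv_entU_apply u _ hu.1 (detp_pos_of_admissible u hu)]
  simp [Pi.single_apply]
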